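/- arXiv:0806.1007 — 5 statements merged into one kernel-verified Lean document; each statement's English description precedes it below -/
import Mathlib

section
/- Let p ∈ (0,1), and let r, n be integers with 1 ≤ r ≤ n and rp < 2. Then π := Σ_{x=1}^∞ (1−p)^{r(x−1)} p^r (1 − (1−p)^{x−1} p)^{n−r} satisfies π ≥ p^{r−1}/r − 2(n−r)p^r/((r+1)(2−rp)). -/
/-- Second-order Bonferroni upper bound for `(1 - p) ^ s`. -/
theorem one_sub_pow_le_quadratic {p : ℝ} (h0 : 0 ≤ p) (h1 : p ≤ 1) (s : ℕ) :
    (1 - p) ^ s ≤ 1 - s * p + s * (s - 1) / 2 * p ^ 2 := by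
  induction s with
  | zero => simp
  | succ s ih =>
    have hs : (0 : ℝ) ≤ s * (s - 1) := by
      rcases s with _ | s
      · simp
      · push_cast
        have : (0 : ℝ) ≤ s := s.cast_nonneg
        nlinarith
    have h := mul_le_mul_of_nonneg_right ih (sub_nonneg.2 h1)
    have h3 : 0 ≤ (s : ℝ) * (s - 1) * p ^ 3 := by positivity
    rw [pow_succ]
    push_cast
    nlinarith

/-- Union bound, summed against a geometric weight. -/
theorem tsum_geometric_union_bound {p : ℝ} (h0 : 0 < p) (h1 : p < 1) {r : ℕ} (hr : r ≠ 0)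
    (m : ℕ) :
    Summable (fun k : ℕ ↦ (1 - p) ^ (r * k) * p ^ r * (1 - (1 - p) ^ k * p) ^ m) ∧
    p ^ r / (1 - (1 - p) ^ r) - m * p ^ (r + 1) / (1 - (1 - p) ^ (r + 1)) ≤
      ∑' k : ℕ, (1 - p) ^ (r * k) * p ^ r * (1 - (1 - p) ^ k * p) ^ m := by
  have hq0 : 0 ≤ 1 - p := by linarith
  have hq1 : 1 - p < 1 := by linarith
  have hg : ∀ s : ℕ, s ≠ 0 →
      HasSum (fun k : ℕ ↦ ((1 - p) ^ s) ^ k) (1 - (1 - p) ^ s)⁻¹ := fun s hs ↦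
    hasSum_geometric_of_lt_one (pow_nonneg hq0 s) (pow_lt_one₀ hq0 hq1 hs)
  have ht : ∀ k : ℕ, 0 ≤ (1 - p) ^ k * p ∧ (1 - p) ^ k * p ≤ 1 := fun k ↦
    ⟨by positivity, mul_le_one₀ (pow_le_one₀ hq0 hq1.le) h0.le h1.le⟩
  have hsum : Summable (fun k : ℕ ↦ (1 - p) ^ (r * k) * p ^ r * (1 - (1 - p) ^ k * p) ^ m) := by
    refine Summable.of_nonneg_of_le (fun k ↦ ?_) (fun k ↦ ?_)
      ((hg r hr).summable.mul_right (p ^ r))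
    · have := sub_nonneg.2 (ht k).2
      positivity
    · rw [← pow_mul]
      exact mul_le_of_le_one_right (by positivity)
        (pow_le_one₀ (sub_nonneg.2 (ht k).2) (by linarith [(ht k).1]))
  refine ⟨hsum, ?_⟩
  have hlow := ((hg r hr).mul_left (p ^ r)).sub
    ((hg (r + 1) r.succ_ne_zero).mul_left (m * p ^ (r + 1)))
  rw [← div_eq_mul_inv, ← div_eq_mul_inv] at hlow
  refine hasSum_le (fun k ↦ ?_) hlow hsum.hasSum
  have hb := one_add_mul_le_pow (a := -((1 - p) ^ k * p)) (by linarith [(ht k).2]) m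
  rw [← sub_eq_add_neg 1 ((1 - p) ^ k * p)] at hb
  calc p ^ r * ((1 - p) ^ r) ^ k - m * p ^ (r + 1) * ((1 - p) ^ (r + 1)) ^ k
      = (1 - p) ^ (r * k) * p ^ r * (1 + m * -((1 - p) ^ k * p)) := by
        rw [← pow_mul, ← pow_mul, add_mul, one_mul, pow_add, pow_succ]
        ring
    _ ≤ _ := mul_le_mul_of_nonneg_left hb (by positivity)

/-- Lower bound on the probability `π = Σ_{x≥1} (1-p)^{r(x-1)} p^r (1-(1-p)^{x-1}p)^{n-r}`
that a fixed set of `r` of `n` i.i.d. Geometric(p) players share a score held by no one else: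
`π ≥ p^{r-1}/r − 2(n−r)p^r/((r+1)(2−rp))`. -/
theorem stmt_8 (p : ℝ) (hp : p ∈ Set.Ioo (0 : ℝ) 1) (r n : ℕ)
    (hr : 1 ≤ r) (hrn : r ≤ n) (hrp : (r : ℝ) * p < 2)
    (pi : ℝ)
    (hpi : pi = ∑' x : ℕ, if 1 ≤ x then
      (1 - p) ^ (r * (x - 1)) * p ^ r * (1 - (1 - p) ^ (x - 1) * p) ^ (n - r) else 0) :
    p ^ (r - 1) / r - 2 * ((n : ℝ) - r) * p ^ r / ((r + 1) * (2 - r * p)) ≤ pi := by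
  obtain ⟨h0, h1⟩ := hp
  have hr0 : r ≠ 0 := by omega
  have hrpos : (0 : ℝ) < r := by exact_mod_cast hr
  obtain ⟨hsum, hle⟩ := tsum_geometric_union_bound h0 h1 hr0 (n - r)
  have hpi' : pi = ∑' k : ℕ, (1 - p) ^ (r * k) * p ^ r * (1 - (1 - p) ^ k * p) ^ (n - r) := by
    rw [hpi, Summable.tsum_eq_zero_add ((summable_nat_add_iff 1).1 (by simpa using hsum))]
    simp
  rw [hpi']
  refine le_trans (sub_le_sub ?_ ?_) hle
  · have hB := one_add_mul_le_pow (a := -p) (by linarith) r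
    rw [← sub_eq_add_neg 1 p] at hB
    have hd : 0 < 1 - (1 - p) ^ r := sub_pos.2 (pow_lt_one₀ (by linarith) (by linarith) hr0)
    obtain ⟨s, rfl⟩ := Nat.exists_eq_add_one_of_ne_zero hr0
    rw [div_le_div_iff₀ hrpos hd, Nat.add_sub_cancel, pow_succ p s, mul_assoc]
    exact mul_le_mul_of_nonneg_left (by linarith) (by positivity)
  · have hQ := one_sub_pow_le_quadratic h0.le h1.le (r + 1)
    push_cast at hQ
    have hc : 0 < 2 - r * p := by linarith
    have hm : (0 : ℝ) ≤ (n : ℝ) - r := sub_nonneg.2 (by exact_mod_cast hrn)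
    have hd : (r + 1) * (2 - r * p) * p / 2 ≤ 1 - (1 - p) ^ (r + 1) := by linarith
    rw [Nat.cast_sub hrn]
    calc ((n : ℝ) - r) * p ^ (r + 1) / (1 - (1 - p) ^ (r + 1))
        ≤ ((n : ℝ) - r) * p ^ (r + 1) / ((r + 1) * (2 - r * p) * p / 2) :=
          div_le_div_of_nonneg_left (by positivity) (by positivity) hd
      _ = 2 * ((n : ℝ) - r) * p ^ r / ((r + 1) * (2 - r * p)) := by
          rw [pow_succ]
          field_simp
end

section
/- Let p ∈ (0,1), and let r, n be integers with 1 ≤ r ≤ n, (r−1)p < 2 and (r+1)p < 2. Then π := Σ_{x=1}^∞ (1−p)^{r(x−1)} p^r (1 − (1−p)^{x−1} p)^{n−r} satisfies π ≤ 2p^{r−1}/(r(2−(r−1)p)) − (n−r)p^r/(r+1) + (n−r)²p^{r+1}/((r+2)(2−(r+1)p)). -/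
/-- The second-order Bonferroni inequality for powers. -/
theorem one_sub_pow_le_quadratic_s9 {y : ℝ} (hy₀ : 0 ≤ y) (hy₁ : y ≤ 1) (m : ℕ) :
    (1 - y) ^ m ≤ 1 - m * y + m * (m - 1) / 2 * y ^ 2 := by
  induction m with
  | zero => simp
  | succ m ih =>
    have hc : (0 : ℝ) ≤ m * (m - 1) := by
      rcases m with _ | m
      · simp
      · push_cast
        nlinarith [(Nat.cast_nonneg m : (0 : ℝ) ≤ m)]
    have h := mul_le_mul_of_nonneg_right ih (sub_nonneg.2 hy₁)
    have h₃ : 0 ≤ (m * (m - 1) : ℝ) * y ^ 3 := mul_nonneg hc (by positivity)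
    rw [pow_succ]
    push_cast
    nlinarith

theorem hasSum_pow_mul_geometric {p : ℝ} (hp₀ : 0 < p) (hp₁ : p < 1) {k : ℕ} (hk : k ≠ 0) :
    HasSum (fun j : ℕ => ((1 - p) ^ j * p) ^ k) (p ^ k / (1 - (1 - p) ^ k)) := by
  have h := (hasSum_geometric_of_lt_one (pow_nonneg (by linarith : 0 ≤ 1 - p) k)
    (pow_lt_one₀ (by linarith) (by linarith) hk)).mul_left (p ^ k)
  rw [← div_eq_mul_inv] at h
  refine h.congr_fun ?_
  intro j
  rw [mul_pow, ← pow_mul, ← pow_mul, mul_comm j k, mul_comm]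

theorem pow_div_one_sub_pow_le {p : ℝ} (hp₀ : 0 < p) (hp₁ : p < 1) (k : ℕ)
    (hk : (k : ℝ) * p < 2) :
    p ^ (k + 1) / (1 - (1 - p) ^ (k + 1)) ≤ 2 * p ^ k / ((k + 1) * (2 - k * p)) := by
  have h := one_sub_pow_le_quadratic_s9 hp₀.le hp₁.le (k + 1)
  push_cast at h
  have hD : 0 < ((k : ℝ) + 1) * (2 - k * p) := mul_pos (by positivity) (by linarith)
  have hden : p * (((k : ℝ) + 1) * (2 - k * p)) / 2 ≤ 1 - (1 - p) ^ (k + 1) := by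
    nlinarith
  calc p ^ (k + 1) / (1 - (1 - p) ^ (k + 1))
      ≤ p ^ (k + 1) / (p * (((k : ℝ) + 1) * (2 - k * p)) / 2) := by gcongr
    _ = 2 * p ^ k / ((k + 1) * (2 - k * p)) := by
      rw [pow_succ, div_eq_div_iff (by positivity) hD.ne']
      ring

theorem pow_div_le_pow_div_one_sub_pow {p : ℝ} (hp₀ : 0 < p) (hp₁ : p < 1) (k : ℕ) :
    p ^ k / (k + 1) ≤ p ^ (k + 1) / (1 - (1 - p) ^ (k + 1)) := by
  have h := one_add_mul_le_pow (by linarith : (-2 : ℝ) ≤ -p) (k + 1)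
  push_cast at h
  rw [← sub_eq_add_neg] at h
  have hlt : (1 - p) ^ (k + 1) < 1 := pow_lt_one₀ (by linarith) (by linarith) k.succ_ne_zero
  rw [div_le_div_iff₀ (by positivity) (by linarith), pow_succ p, mul_assoc]
  gcongr
  linarith


/-- Upper bound on the probability `π = Σ_{x≥1} (1-p)^{r(x-1)} p^r (1-(1-p)^{x-1}p)^{n-r}`
that a fixed set of `r` of `n` i.i.d. Geometric(p) players share a score held by no one else:
`π ≤ 2p^{r-1}/(r(2−(r−1)p)) − (n−r)p^r/(r+1) + (n−r)²p^{r+1}/((r+2)(2−(r+1)p))`. -/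
theorem stmt_9 (p : ℝ) (hp : p ∈ Set.Ioo (0 : ℝ) 1) (r n : ℕ)
    (hr : 1 ≤ r) (hrn : r ≤ n)
    (hrp₁ : ((r : ℝ) - 1) * p < 2) (hrp₂ : ((r : ℝ) + 1) * p < 2)
    (pi : ℝ)
    (hpi : pi = ∑' x : ℕ, if 1 ≤ x then
      (1 - p) ^ (r * (x - 1)) * p ^ r * (1 - (1 - p) ^ (x - 1) * p) ^ (n - r) else 0) :
    pi ≤ 2 * p ^ (r - 1) / (r * (2 - ((r : ℝ) - 1) * p))
        - ((n : ℝ) - r) * p ^ r / (r + 1)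
        + ((n : ℝ) - r) ^ 2 * p ^ (r + 1) / ((r + 2) * (2 - ((r : ℝ) + 1) * p)) := by
  obtain ⟨hp₀, hp₁⟩ := hp
  obtain ⟨k, rfl⟩ : ∃ k, r = k + 1 := ⟨r - 1, by omega⟩
  obtain ⟨m, rfl⟩ := Nat.exists_eq_add_of_le hrn
  simp only [Nat.add_sub_cancel_left, Nat.add_sub_cancel] at hpi ⊢
  push_cast at hrp₁ hrp₂ ⊢
  have hS := (((hasSum_pow_mul_geometric hp₀ hp₁ k.succ_ne_zero).sub
    ((hasSum_pow_mul_geometric hp₀ hp₁ (k + 1).succ_ne_zero).mul_left (m : ℝ))).add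
    ((hasSum_pow_mul_geometric hp₀ hp₁ (k + 2).succ_ne_zero).mul_left ((m : ℝ) ^ 2 / 2)))
  simp only [Nat.succ_eq_add_one] at hS
  have hy₀ (j : ℕ) : 0 ≤ (1 - p) ^ j * p := mul_nonneg (pow_nonneg (by linarith) j) hp₀.le
  have hy₁ (j : ℕ) : (1 - p) ^ j * p ≤ 1 :=
    mul_le_one₀ (pow_le_one₀ (by linarith) (by linarith)) hp₀.le hp₁.le
  have hterm (j : ℕ) :
      ((1 - p) ^ j * p) ^ (k + 1) * (1 - (1 - p) ^ j * p) ^ m ≤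
        ((1 - p) ^ j * p) ^ (k + 1) - m * ((1 - p) ^ j * p) ^ (k + 1 + 1)
          + (m : ℝ) ^ 2 / 2 * ((1 - p) ^ j * p) ^ (k + 2 + 1) := by
    have h := one_sub_pow_le_quadratic_s9 (hy₀ j) (hy₁ j) m
    have hyj := hy₀ j
    generalize (1 - p) ^ j * p = y at h hyj ⊢
    calc y ^ (k + 1) * (1 - y) ^ m
        ≤ y ^ (k + 1) * (1 - m * y + m ^ 2 / 2 * y ^ 2) := by
          refine mul_le_mul_of_nonneg_left (h.trans ?_) (by positivity)
          nlinarith [mul_nonneg (Nat.cast_nonneg m : (0 : ℝ) ≤ m) (sq_nonneg y)]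
      _ = _ := by ring
  have hsum : Summable fun j : ℕ => ((1 - p) ^ j * p) ^ (k + 1) * (1 - (1 - p) ^ j * p) ^ m :=
    .of_nonneg_of_le
      (fun j => mul_nonneg (pow_nonneg (hy₀ j) _) (pow_nonneg (sub_nonneg.2 (hy₁ j)) _))
      hterm hS.summable
  have hpi' : pi = ∑' j : ℕ, ((1 - p) ^ j * p) ^ (k + 1) * (1 - (1 - p) ^ j * p) ^ m := by
    have hshift (j : ℕ) : (if 1 ≤ j + 1 then
        (1 - p) ^ ((k + 1) * (j + 1 - 1)) * p ^ (k + 1) * (1 - (1 - p) ^ (j + 1 - 1) * p) ^ m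
        else 0) = ((1 - p) ^ j * p) ^ (k + 1) * (1 - (1 - p) ^ j * p) ^ m := by
      rw [if_pos (by omega), Nat.add_sub_cancel, mul_pow, ← pow_mul, mul_comm j]
    rw [hpi, Summable.tsum_eq_zero_add ((summable_nat_add_iff 1).1 (by simpa only [hshift]))]
    simp only [hshift]
    simp
  have hle := (hsum.tsum_le_tsum hterm hS.summable).trans_eq hS.tsum_eq
  rw [← hpi'] at hle
  have h₁ := pow_div_one_sub_pow_le hp₀ hp₁ k (by linarith)
  have h₂ := mul_le_mul_of_nonneg_left (pow_div_le_pow_div_one_sub_pow hp₀ hp₁ (k + 1))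
    (Nat.cast_nonneg m : (0 : ℝ) ≤ m)
  have h₃ := mul_le_mul_of_nonneg_left
    (pow_div_one_sub_pow_le hp₀ hp₁ (k + 2) (by push_cast; linarith))
    (by positivity : (0 : ℝ) ≤ (m : ℝ) ^ 2 / 2)
  push_cast at h₂ h₃
  refine hle.trans ((add_le_add (sub_le_sub h₁ h₂) h₃).trans_eq ?_)
  ring_nf
end

section
/- Let N ≥ 2, r ≥ 1 and n ≥ 2r be integers, and set λ = C(n,r) N^{1−r} (1 − 1/N)^{n−r}. Then C(n−r, r) · (N−1) · N^{−r} · (1 − 1/(N−1))^{n−2r} · ((N/(N−1))^r − ((N−1)/N)^r) ≤ (2r/N) · exp(2r/(N−1)) · λ. -/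
/-- Bernoulli's inequality in the form `x⁻ʳ - xʳ ≤ 2r(1 - x)x⁻ʳ`. -/
lemma inv_pow_sub_pow_le {x : ℝ} (hx : 0 < x) (r : ℕ) :
    x⁻¹ ^ r - x ^ r ≤ 2 * r * (1 - x) * x⁻¹ ^ r := by
  have hb := one_add_mul_sub_le_pow (a := x) (by linarith) (2 * r)
  push_cast at hb
  have hxr : x ^ r = x ^ (2 * r) * x⁻¹ ^ r := by
    rw [two_mul, pow_add, mul_assoc, ← mul_pow, mul_inv_cancel₀ hx.ne', one_pow, mul_one]
  have hmul := mul_le_mul_of_nonneg_right hb (show 0 ≤ x⁻¹ ^ r by positivity)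
  rw [hxr]
  linarith

/-- The Case-I coupling term in the uniform occupancy model:
`C(n−r,r)(N−1)N^{−r}(1−1/(N−1))^{n−2r}((N/(N−1))^r − ((N−1)/N)^r)
  ≤ (2r/N) e^{2r/(N−1)} λ`,
where `λ = C(n,r) N^{1−r} (1−1/N)^{n−r}`. -/
theorem stmt_12 (N r n : ℕ) (hN : 2 ≤ N) (hr : 1 ≤ r) (hn : 2 * r ≤ n)
    (lam : ℝ)
    (hlam : lam = (n.choose r : ℝ) * (1 / N) ^ (r - 1) * (1 - 1 / (N : ℝ)) ^ (n - r)) :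
    ((n - r).choose r : ℝ) * ((N : ℝ) - 1) * (1 / N) ^ r *
        (1 - 1 / ((N : ℝ) - 1)) ^ (n - 2 * r) *
        (((N : ℝ) / (N - 1)) ^ r - (((N : ℝ) - 1) / N) ^ r)
      ≤ 2 * r / N * Real.exp (2 * r / ((N : ℝ) - 1)) * lam := by
  have hN' : (2 : ℝ) ≤ N := by exact_mod_cast hN
  have hN0 : (0 : ℝ) < N := by linarith
  have hM0 : (0 : ℝ) < N - 1 := by linarith
  obtain ⟨x, hx⟩ : ∃ x : ℝ, x = 1 - 1 / (N : ℝ) := ⟨_, rfl⟩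
  have hxdiv : ((N : ℝ) - 1) / N = x := by rw [hx]; field_simp
  have hxinv : (N : ℝ) / (N - 1) = x⁻¹ := by rw [← hxdiv, inv_div]
  have hx0 : 0 < x := by rw [← hxdiv]; positivity
  have hx1 : x ≤ 1 := by
    rw [hx]
    linarith [show (0 : ℝ) < 1 / N by positivity]
  have hq : 1 - x = 1 / N := by rw [hx]; ring
  have hbase0 : 0 ≤ 1 - 1 / ((N : ℝ) - 1) := by
    rw [sub_nonneg, div_le_one hM0]
    linarith
  have hbase : 1 - 1 / ((N : ℝ) - 1) ≤ x := by
    rw [hx]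
    gcongr
    linarith
  have hchoose : ((n - r).choose r : ℝ) ≤ n.choose r := by
    exact_mod_cast Nat.choose_le_choose r (Nat.sub_le n r)
  have hprefactor : ((N : ℝ) - 1) * (1 / N) ^ r ≤ (1 / N) ^ (r - 1) := by
    obtain ⟨k, rfl⟩ := Nat.exists_eq_add_of_le' hr
    calc ((N : ℝ) - 1) * (1 / N) ^ (k + 1) = x * (1 / N) ^ k := by
          rw [← hxdiv]; ring
      _ ≤ (1 / N) ^ k := mul_le_of_le_one_left (by positivity) hx1
  have hexp : x⁻¹ ^ (2 * r) ≤ Real.exp (2 * r / ((N : ℝ) - 1)) := by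
    have hxinv' : x⁻¹ = 1 / ((N : ℝ) - 1) + 1 := by
      rw [← hxinv]; field_simp; ring
    calc x⁻¹ ^ (2 * r) ≤ Real.exp (1 / ((N : ℝ) - 1)) ^ (2 * r) := by
          gcongr
          rw [hxinv']
          exact Real.add_one_le_exp _
      _ = Real.exp (2 * r / ((N : ℝ) - 1)) := by
          rw [← Real.exp_nat_mul]
          congr 1
          push_cast
          ring
  have hpow : x ^ (n - 2 * r) * x⁻¹ ^ r = x⁻¹ ^ (2 * r) * x ^ (n - r) := by
    obtain ⟨m, rfl⟩ := Nat.exists_eq_add_of_le' hn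
    rw [show m + 2 * r - 2 * r = m by omega, show m + 2 * r - r = m + r by omega]
    have hcancel : x⁻¹ ^ r * x ^ r = 1 := by
      rw [← mul_pow, inv_mul_cancel₀ hx0.ne', one_pow]
    rw [two_mul, pow_add, pow_add]
    linear_combination (-(x ^ m * x⁻¹ ^ r)) * hcancel
  have hdiff := inv_pow_sub_pow_le hx0 r
  rw [hq] at hdiff
  rw [hlam, ← hx, hxdiv, hxinv]
  calc ((n - r).choose r : ℝ) * ((N : ℝ) - 1) * (1 / N) ^ r *
        (1 - 1 / ((N : ℝ) - 1)) ^ (n - 2 * r) * (x⁻¹ ^ r - x ^ r)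
      ≤ ((n - r).choose r : ℝ) * ((N : ℝ) - 1) * (1 / N) ^ r *
        (1 - 1 / ((N : ℝ) - 1)) ^ (n - 2 * r) * (2 * r * (1 / N) * x⁻¹ ^ r) := by
        gcongr
    _ = ((n - r).choose r : ℝ) * (((N : ℝ) - 1) * (1 / N) ^ r) *
        (1 - 1 / ((N : ℝ) - 1)) ^ (n - 2 * r) * (2 * r * (1 / N) * x⁻¹ ^ r) := by
        ring
    _ ≤ (n.choose r : ℝ) * (1 / N) ^ (r - 1) * x ^ (n - 2 * r) *
        (2 * r * (1 / N) * x⁻¹ ^ r) := by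
        gcongr
    _ = (n.choose r : ℝ) * (1 / N) ^ (r - 1) * (2 * r / N) *
        (x ^ (n - 2 * r) * x⁻¹ ^ r) := by
        ring
    _ = 2 * r / N * x⁻¹ ^ (2 * r) * ((n.choose r : ℝ) * (1 / N) ^ (r - 1) * x ^ (n - r)) := by
        rw [hpow]; ring
    _ ≤ _ := by
        gcongr
end

section
/- Let p ∈ (0,1), r ≥ 1 and n ≥ 2r be integers, and set p_z = (1−p)^{z−1} p for integers z ≥ 1 and λ = C(n,r) Σ_{y=1}^∞ p_y^r (1−p_y)^{n−r}. Then for every integer x ≥ 1: C(n−r, r) · Σ_{y ≥ 1, y ≠ x} p_y^r (1 − p_y/(1−p_x))^{n−2r} ((1−p_x)^{−r} − (1−p_y)^r) ≤ 2rp · exp(2rp/(1−p)) · λ. -/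
theorem inv_pow_mul_inv_pow_sub_one_le {p a b : ℝ} (hp : p < 1) (ha : 0 ≤ a) (hap : a ≤ p)
    (hb : 0 ≤ b) (hbp : b ≤ p) (r : ℕ) :
    (1 - a)⁻¹ ^ r * (1 - b)⁻¹ ^ r - 1 ≤ 2 * r * p * Real.exp (2 * r * p / (1 - p)) := by
  have inv_le {c : ℝ} (hc : c ≤ p) : (1 - c)⁻¹ ^ r ≤ Real.exp (r * (p / (1 - p))) := by
    have h : (1 - c)⁻¹ ≤ Real.exp (p / (1 - p)) := calc
      (1 - c)⁻¹ ≤ (1 - p)⁻¹ := by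
        apply inv_anti₀ <;> linarith
      _ = p / (1 - p) + 1 := by
        field_simp [(sub_pos.2 hp).ne']
        ring
      _ ≤ _ := Real.add_one_le_exp _
    rw [Real.exp_nat_mul]
    exact pow_le_pow_left₀ (inv_nonneg.2 (by linarith)) h r
  have hs : 0 < (1 - a) * (1 - b) := mul_pos (by linarith) (by linarith)
  set t := (1 - a)⁻¹ ^ r * (1 - b)⁻¹ ^ r with ht
  have hts : t * ((1 - a) * (1 - b)) ^ r = 1 := by
    rw [ht, ← mul_pow, ← mul_pow, ← mul_inv, inv_mul_cancel₀ hs.ne', one_pow]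
  have ht0 : 0 ≤ t := by
    by_contra! h
    nlinarith [pow_pos hs r]
  have hbern : 1 - ((1 - a) * (1 - b)) ^ r ≤ 2 * r * p := by
    have h := one_add_mul_le_pow (a := (1 - a) * (1 - b) - 1) (by linarith) r
    rw [add_sub_cancel] at h
    have hr : (0 : ℝ) ≤ r := r.cast_nonneg
    nlinarith [mul_nonneg hr (sub_nonneg.2 hap), mul_nonneg hr (sub_nonneg.2 hbp),
      mul_nonneg hr (mul_nonneg ha hb)]
  have hte : t ≤ Real.exp (2 * r * p / (1 - p)) := calc
    t ≤ Real.exp (r * (p / (1 - p))) * Real.exp (r * (p / (1 - p))) :=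
      mul_le_mul (inv_le hap) (inv_le hbp) (pow_nonneg (inv_nonneg.2 (by linarith)) r)
        (Real.exp_nonneg _)
    _ = _ := by
      rw [← Real.exp_add]
      congr 1
      ring
  have hp0 : 0 ≤ p := ha.trans hap
  calc
    t - 1 = (1 - ((1 - a) * (1 - b)) ^ r) * t := by linarith
    _ ≤ 2 * r * p * Real.exp (2 * r * p / (1 - p)) :=
      mul_le_mul hbern hte ht0 (by positivity)

theorem coupling_term_nonneg {a b : ℝ} (ha : 0 ≤ a) (ha1 : a < 1) (hb : 0 ≤ b) (hab : a + b ≤ 1)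
    (r k : ℕ) :
    0 ≤ b ^ r * (1 - b / (1 - a)) ^ k * ((1 - a)⁻¹ ^ r - (1 - b) ^ r) := by
  have h1 : 0 ≤ 1 - b / (1 - a) := by
    rw [sub_nonneg, div_le_one (by linarith)]
    linarith
  have h2 : (1 - b) ^ r ≤ 1 := pow_le_one₀ (by linarith) (by linarith)
  have h3 : 1 ≤ (1 - a)⁻¹ ^ r := one_le_pow₀ ((one_le_inv₀ (by linarith)).2 (by linarith))
  have h4 : 0 ≤ (1 - a)⁻¹ ^ r - (1 - b) ^ r := by linarith
  positivity

theorem coupling_term_le {p a b : ℝ} (hp : p < 1) (ha : 0 ≤ a) (hap : a ≤ p)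
    (hb : 0 ≤ b) (hbp : b ≤ p) (hab : a + b ≤ 1) {r n : ℕ} (hn : 2 * r ≤ n) :
    b ^ r * (1 - b / (1 - a)) ^ (n - 2 * r) * ((1 - a)⁻¹ ^ r - (1 - b) ^ r) ≤
      2 * r * p * Real.exp (2 * r * p / (1 - p)) * (b ^ r * (1 - b) ^ (n - r)) := by
  have ha1 : 0 < 1 - a := by linarith
  have hb1 : 0 < 1 - b := by linarith
  have h1 : 0 ≤ 1 - b / (1 - a) := by
    rw [sub_nonneg, div_le_one ha1]
    linarith
  have h2 : 1 - b / (1 - a) ≤ 1 - b := by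
    have : b ≤ b / (1 - a) := le_div_self hb ha1 (by linarith)
    linarith
  have h3 : (1 - b) ^ r ≤ (1 - a)⁻¹ ^ r :=
    pow_le_pow_left₀ hb1.le (le_trans (by linarith) ((one_le_inv₀ ha1).2 (by linarith))) r
  have h4 : (1 - b)⁻¹ ^ r * (1 - b) ^ r = 1 := by
    rw [← mul_pow, inv_mul_cancel₀ hb1.ne', one_pow]
  calc
    _ ≤ b ^ r * (1 - b) ^ (n - 2 * r) * ((1 - a)⁻¹ ^ r - (1 - b) ^ r) := by
      have := sub_nonneg.2 h3
      gcongr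
    _ = ((1 - a)⁻¹ ^ r * (1 - b)⁻¹ ^ r - 1) * (b ^ r * (1 - b) ^ (n - r)) := by
      rw [show n - r = n - 2 * r + r by omega, pow_add]
      linear_combination (-(b ^ r * (1 - b) ^ (n - 2 * r) * (1 - a)⁻¹ ^ r)) * h4
    _ ≤ _ := by
      gcongr
      exact inv_pow_mul_inv_pow_sub_one_le hp ha hap hb hbp r

theorem geometric_mass_add_le_one {p : ℝ} (hp0 : 0 ≤ p) (hp1 : p ≤ 1) {i j : ℕ} (hij : i ≠ j) :
    (1 - p) ^ i * p + (1 - p) ^ j * p ≤ 1 := by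
  wlog h : i < j generalizing i j
  · rw [add_comm]
    exact this hij.symm (by omega)
  have h1 : (1 - p) ^ i ≤ 1 := pow_le_one₀ (by linarith) (by linarith)
  have h2 : (1 - p) ^ j ≤ 1 - p := pow_le_of_le_one (by linarith) (by linarith) (by omega)
  nlinarith [mul_le_mul_of_nonneg_right h1 hp0, mul_le_mul_of_nonneg_right h2 hp0,
    sq_nonneg (1 - p)]


/-- The Case-I coupling term in the geometric occupancy model, with `p_z = (1−p)^{z−1} p`
and `λ = C(n,r) Σ_{y≥1} p_y^r (1−p_y)^{n−r}`: for every `x ≥ 1`,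
`C(n−r,r) Σ_{y≥1, y≠x} p_y^r (1 − p_y/(1−p_x))^{n−2r} ((1−p_x)^{−r} − (1−p_y)^r)
  ≤ 2rp e^{2rp/(1−p)} λ`. -/
theorem stmt_13 (p : ℝ) (hp : p ∈ Set.Ioo (0 : ℝ) 1) (r n : ℕ)
    (hr : 1 ≤ r) (hn : 2 * r ≤ n)
    (pz : ℕ → ℝ) (hpz : ∀ z, pz z = (1 - p) ^ (z - 1) * p)
    (lam : ℝ)
    (hlam : lam = (n.choose r : ℝ) *
      ∑' y : ℕ, if 1 ≤ y then pz y ^ r * (1 - pz y) ^ (n - r) else 0)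
    (x : ℕ) (hx : 1 ≤ x) :
    ((n - r).choose r : ℝ) *
        (∑' y : ℕ, if 1 ≤ y ∧ y ≠ x then
          pz y ^ r * (1 - pz y / (1 - pz x)) ^ (n - 2 * r) *
            ((1 - pz x)⁻¹ ^ r - (1 - pz y) ^ r)
          else 0)
      ≤ 2 * r * p * Real.exp (2 * r * p / (1 - p)) * lam := by
  obtain ⟨hp0, hp1⟩ := hp
  have hz0 (z : ℕ) : 0 ≤ pz z := by
    rw [hpz]
    exact mul_nonneg (pow_nonneg (by linarith) _) hp0.le
  have hzp (z : ℕ) : pz z ≤ p := by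
    rw [hpz]
    exact mul_le_of_le_one_left hp0.le (pow_le_one₀ (by linarith) (by linarith))
  have hadd {y : ℕ} (h : 1 ≤ y ∧ y ≠ x) : pz x + pz y ≤ 1 := by
    rw [hpz, hpz]
    exact geometric_mass_add_le_one hp0.le hp1.le (by omega)
  set K := 2 * r * p * Real.exp (2 * r * p / (1 - p)) with hK
  have hK0 : 0 ≤ K := by positivity
  set f : ℕ → ℝ := fun y ↦ if 1 ≤ y ∧ y ≠ x then
    pz y ^ r * (1 - pz y / (1 - pz x)) ^ (n - 2 * r) * ((1 - pz x)⁻¹ ^ r - (1 - pz y) ^ r)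
    else 0 with hf
  set g : ℕ → ℝ := fun y ↦ if 1 ≤ y then pz y ^ r * (1 - pz y) ^ (n - r) else 0 with hg
  have hg0 (y : ℕ) : 0 ≤ g y := by
    simp only [hg]
    split_ifs
    · exact mul_nonneg (pow_nonneg (hz0 y) _) (pow_nonneg (by linarith [hzp y]) _)
    · rfl
  have hf0 (y : ℕ) : 0 ≤ f y := by
    simp only [hf]
    split_ifs with h
    · exact coupling_term_nonneg (hz0 x) ((hzp x).trans_lt hp1) (hz0 y) (hadd h) _ _
    · rfl
  have hfg (y : ℕ) : f y ≤ K * g y := by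
    by_cases h : 1 ≤ y ∧ y ≠ x
    · simp only [hf, hg, if_pos h, if_pos h.1]
      exact coupling_term_le hp1 (hz0 x) (hzp x) (hz0 y) (hzp y) (hadd h) hn
    · simp only [hf, if_neg h]
      exact mul_nonneg hK0 (hg0 y)
  have hgs : Summable g := by
    rw [← summable_nat_add_iff 1]
    refine Summable.of_nonneg_of_le (fun y ↦ hg0 _) (fun y ↦ ?_)
      ((summable_geometric_of_lt_one (r := 1 - p) (by linarith) (by linarith)).mul_right p)
    calc
      g (y + 1) = pz (y + 1) ^ r * (1 - pz (y + 1)) ^ (n - r) := if_pos (by omega)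
      _ ≤ pz (y + 1) ^ r := mul_le_of_le_one_right (pow_nonneg (hz0 _) _)
        (pow_le_one₀ (by linarith [hzp (y + 1)]) (by linarith [hz0 (y + 1)]))
      _ ≤ pz (y + 1) := pow_le_of_le_one (hz0 _) (by linarith [hzp (y + 1)]) (by omega)
      _ = (1 - p) ^ y * p := by rw [hpz, Nat.add_sub_cancel]
  have hsum : ∑' y, f y ≤ K * ∑' y, g y := by
    rw [← tsum_mul_left]
    exact (Summable.of_nonneg_of_le hf0 hfg (hgs.mul_left K)).tsum_le_tsum hfg (hgs.mul_left K)
  calc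
    ((n - r).choose r : ℝ) * ∑' y, f y ≤ (n.choose r : ℝ) * (K * ∑' y, g y) := by
      gcongr
      · exact tsum_nonneg hf0
      · exact Nat.sub_le n r
    _ = K * lam := by
      rw [hlam]
      ring
end

section
/- Let (n_k) and (N_k) be sequences of integers with n_k → ∞, N_k ≥ 2, and n_k/N_k → 0 as k → ∞. Then Σ_{a=2}^{n_k} C(n_k, a) · N_k^{2−2a} · (1 − 1/N_k)^{2n_k − 2a} → 0 as k → ∞. -/
open Filter

theorem choose_mul_inv_pow_mul_pow_le_div_pow {n N a : ℕ} (hN : 1 ≤ N) (ha : 2 ≤ a) (m : ℕ) :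
    (n.choose a : ℝ) * (1 / (N : ℝ)) ^ (2 * a - 2) * (1 - 1 / (N : ℝ)) ^ m
      ≤ ((n : ℝ) / N) ^ a := by
  have hN' : (1 : ℝ) ≤ N := by exact_mod_cast hN
  have h0 : 0 ≤ 1 / (N : ℝ) := by positivity
  have h1 : 1 / (N : ℝ) ≤ 1 := by rw [div_le_one (by linarith)]; exact hN'
  calc (n.choose a : ℝ) * (1 / (N : ℝ)) ^ (2 * a - 2) * (1 - 1 / (N : ℝ)) ^ m
      ≤ (n.choose a : ℝ) * (1 / (N : ℝ)) ^ (2 * a - 2) :=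
        mul_le_of_le_one_right (by positivity)
          (pow_le_one₀ (by linarith) (by linarith))
    _ ≤ (n : ℝ) ^ a * (1 / (N : ℝ)) ^ a :=
        mul_le_mul (by exact_mod_cast Nat.choose_le_pow n a)
          (pow_le_pow_of_le_one h0 h1 (by omega)) (by positivity) (by positivity)
    _ = ((n : ℝ) / N) ^ a := by rw [← mul_pow, mul_one_div]

/-- The term `T₁ = Σ_{a=2}^{n} C(n,a) N^{2−2a} (1−1/N)^{2n−2a}` in the multivariate
Poisson approximation tends to `0` whenever `n_k → ∞` and `n_k/N_k → 0`. -/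
theorem stmt_19 (n N : ℕ → ℕ) (hn : Tendsto n atTop atTop) (hN : ∀ k, 2 ≤ N k)
    (hratio : Tendsto (fun k => (n k : ℝ) / (N k : ℝ)) atTop (nhds 0)) :
    Tendsto (fun k => ∑ a ∈ Finset.Icc 2 (n k),
        ((n k).choose a : ℝ) * (1 / (N k : ℝ)) ^ (2 * a - 2) *
          (1 - 1 / (N k : ℝ)) ^ (2 * n k - 2 * a))
      atTop (nhds 0) := by
  have hlim : Tendsto (fun k => ((n k : ℝ) / N k) ^ 2 / (1 - (n k : ℝ) / N k))
      atTop (nhds 0) := by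
    simpa [Pi.div_def] using (hratio.pow 2).div (hratio.const_sub 1) (by norm_num)
  refine squeeze_zero' (Eventually.of_forall fun k => Finset.sum_nonneg fun a _ => ?_) ?_ hlim
  · have hN' : (1 : ℝ) ≤ N k := by exact_mod_cast (one_le_two.trans (hN k))
    have h1 : 0 ≤ 1 - 1 / (N k : ℝ) := by
      rw [sub_nonneg, div_le_one (by linarith)]
      exact hN'
    positivity
  · filter_upwards [hratio.eventually_lt_const one_pos] with k hk
    refine (Finset.sum_le_sum fun a ha => choose_mul_inv_pow_mul_pow_le_div_pow
      (one_le_two.trans (hN k)) (Finset.mem_Icc.1 ha).1 _).trans ?_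
    rw [← Finset.Ico_add_one_right_eq_Icc]
    exact geom_sum_Ico_le_of_lt_one (by positivity) hk
end
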